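/- arXiv:2511.03740 — 7 statements merged into one kernel-verified Lean document; each statement's English description precedes it below -/
import Mathlib

section
/- Let t₀ ∈ ℝ, let Ã : [t₀,∞) → ℝ^{n×n} be continuous, and let K : [t₀,∞) → ℝ^{n×n} be differentiable with K(t) symmetric for each t. Suppose that for every t ≥ t₀ the matrix K'(t) − Ã(t)K(t) − K(t)Ã(t)ᵀ is positive semidefinite, and that K(t₀) is positive semidefinite. Then K(t) is positive semidefinite for every t ≥ t₀. -/
open Matrix

theorem Matrix.dotProduct_mulVec_le_sum_abs {ι : Type*} [Fintype ι] (A : Matrix ι ι ℝ)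
    (v : ι → ℝ) : v ⬝ᵥ A *ᵥ v ≤ (∑ i, ∑ j, |A i j|) * (v ⬝ᵥ v) := by
  have hv : ∀ i, v i * v i ≤ v ⬝ᵥ v := fun i =>
    Finset.single_le_sum (f := fun i => v i * v i) (fun j _ => mul_self_nonneg (v j))
      (Finset.mem_univ i)
  rw [Finset.sum_mul]
  refine Finset.sum_le_sum fun i _ => ?_
  rw [mulVec, dotProduct, Finset.mul_sum, Finset.sum_mul]
  refine Finset.sum_le_sum fun j _ => ?_
  have hij : |v i * v j| ≤ v ⬝ᵥ v := by
    rw [abs_le]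
    constructor <;> nlinarith [hv i, hv j, sq_nonneg (v i - v j), sq_nonneg (v i + v j)]
  calc v i * (A i j * v j) = A i j * (v i * v j) := by ring
    _ ≤ |A i j| * |v i * v j| := by rw [← abs_mul]; exact le_abs_self _
    _ ≤ _ := mul_le_mul_of_nonneg_left hij (abs_nonneg _)

theorem HasDerivAt.dotProduct_mulVec {ι : Type*} [Fintype ι] {K : ℝ → Matrix ι ι ℝ}
    {K' : Matrix ι ι ℝ} {t : ℝ} (h : ∀ i j, HasDerivAt (fun s => K s i j) (K' i j) t)
    (v : ι → ℝ) : HasDerivAt (fun s => v ⬝ᵥ K s *ᵥ v) (v ⬝ᵥ K' *ᵥ v) t := by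
  simp only [dotProduct, mulVec]
  exact HasDerivAt.fun_sum fun i _ =>
    (HasDerivAt.fun_sum fun j _ => (h i j).mul_const (v j)).const_mul (v i)

theorem HasDerivAt.nonpos_of_forall_lt {f : ℝ → ℝ} {f' a τ : ℝ} (hf : HasDerivAt f f' τ)
    (haτ : a < τ) (hpos : ∀ t ∈ Set.Ico a τ, 0 ≤ f t) (hτ : f τ ≤ 0) : f' ≤ 0 := by
  refine le_of_tendsto (hasDerivAt_iff_tendsto_slope_left_right.1 hf).1 ?_
  filter_upwards [Ioo_mem_nhdsLT haτ] with t ht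
  rw [slope_def_field]
  exact div_nonpos_of_nonneg_of_nonpos (by linarith [hpos t ⟨ht.1.le, ht.2⟩]) (by linarith [ht.2])

/-- The strict comparison principle: `K' ≻ AK + KAᵀ` preserves positive definiteness. -/
theorem Matrix.PosDef.of_lyapunov_lt {ι : Type*} [Fintype ι] {a b : ℝ}
    {A K K' : ℝ → Matrix ι ι ℝ}
    (hderiv : ∀ t ∈ Set.Icc a b, ∀ i j, HasDerivAt (fun s => K s i j) (K' t i j) t)
    (hsym : ∀ t ∈ Set.Icc a b, (K t).IsSymm)
    (hlt : ∀ t ∈ Set.Icc a b, (K' t - (A t * K t + K t * (A t)ᵀ)).PosDef)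
    (ha : (K a).PosDef) : ∀ t ∈ Set.Icc a b, (K t).PosDef := by
  classical
  by_contra! ⟨t₁, ht₁, hnot⟩
  let C := Set.Icc a b ×ˢ Metric.sphere (0 : ι → ℝ) 1
  have hC : IsCompact C := isCompact_Icc.prod (isCompact_sphere _ _)
  have hcont : ContinuousOn (fun p : ℝ × (ι → ℝ) => p.2 ⬝ᵥ K p.1 *ᵥ p.2) C := by
    have hK : ∀ i j, ContinuousOn (fun p : ℝ × (ι → ℝ) => K p.1 i j) C := fun i j =>
      ContinuousOn.comp (g := fun s => K s i j) (t := Set.Icc a b)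
        (fun t ht => (hderiv t ht i j).continuousAt.continuousWithinAt)
        continuous_fst.continuousOn fun p hp => hp.1
    simp only [dotProduct, mulVec]
    refine continuousOn_finsetSum _ fun i _ => ContinuousOn.mul (by fun_prop) ?_
    exact continuousOn_finsetSum _ fun j _ => (hK i j).mul (by fun_prop)
  let S := C ∩ (fun p : ℝ × (ι → ℝ) => p.2 ⬝ᵥ K p.1 *ᵥ p.2) ⁻¹' Set.Iic 0
  have hS : IsCompact S :=
    hC.of_isClosed_subset (hcont.preimage_isClosed_of_isClosed hC.isClosed isClosed_Iic)
      Set.inter_subset_left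
  have hmem : ∀ t ∈ Set.Icc a b, ¬ (K t).PosDef → t ∈ Prod.fst '' S := by
    intro t ht hn
    by_contra hcon
    refine hn (.of_dotProduct_mulVec_pos (by simpa using! hsym t ht) fun v hv => ?_)
    by_contra! hle
    refine hcon ⟨(t, ‖v‖⁻¹ • v), ⟨⟨ht, ?_⟩, ?_⟩, rfl⟩
    · simp [norm_smul, norm_ne_zero_iff.2 hv]
    · have h1 : 0 ≤ ‖v‖⁻¹ := by positivity
      simp only [star_trivial] at hle
      simp only [Set.mem_preimage, Set.mem_Iic, mulVec_smul, smul_dotProduct, dotProduct_smul,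
        smul_eq_mul]
      exact mul_nonpos_of_nonneg_of_nonpos h1 (mul_nonpos_of_nonneg_of_nonpos h1 hle)
  obtain ⟨τ, ⟨⟨τ, v⟩, ⟨⟨hτ, hv⟩, hle⟩, rfl⟩, hmin⟩ :=
    (hS.image continuous_fst).exists_isLeast ⟨t₁, hmem t₁ ht₁ hnot⟩
  simp only [Set.mem_preimage, Set.mem_Iic] at hτ hv hle hmin
  have hv0 : v ≠ 0 := by
    rintro rfl
    simp at hv
  have hlow : ∀ t ∈ Set.Ico a τ, (K t).PosDef := by
    intro t ht
    by_contra hn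
    exact absurd (hmin (hmem t ⟨ht.1, ht.2.le.trans hτ.2⟩ hn)) (not_le.2 ht.2)
  have haτ : a < τ := by
    refine lt_of_le_of_ne hτ.1 ?_
    rintro rfl
    have := ha.dotProduct_mulVec_pos hv0
    simp only [star_trivial] at this
    linarith
  have hpsd : (K τ).PosSemidef := by
    refine .of_dotProduct_mulVec_nonneg (by simpa using! hsym τ hτ) fun w => ?_
    have hc := (HasDerivAt.dotProduct_mulVec (hderiv τ hτ) w).continuousAt
    refine ge_of_tendsto (hc.tendsto.mono_left (nhdsWithin_le_nhds (s := Set.Iio τ))) ?_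
    filter_upwards [Ioo_mem_nhdsLT haτ] with t ht
    simpa using (hlow t ⟨ht.1.le, ht.2⟩).posSemidef.dotProduct_mulVec_nonneg w
  have hker : K τ *ᵥ v = 0 := by
    rw [← hpsd.dotProduct_mulVec_zero_iff]
    exact le_antisymm (by simpa using hle) (hpsd.dotProduct_mulVec_nonneg v)
  have hker' : v ᵥ* K τ = 0 := by rw [← mulVec_transpose, hsym τ hτ, hker]
  have hneg : v ⬝ᵥ K' τ *ᵥ v ≤ 0 :=
    (HasDerivAt.dotProduct_mulVec (hderiv τ hτ) v).nonpos_of_forall_lt haτ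
      (fun t ht => by simpa using (hlow t ht).posSemidef.dotProduct_mulVec_nonneg v) hle
  have hpos := (hlt τ hτ).dotProduct_mulVec_pos hv0
  rw [star_trivial, sub_mulVec, add_mulVec, ← mulVec_mulVec, ← mulVec_mulVec, hker, dotProduct_sub,
    dotProduct_add, dotProduct_mulVec v (K τ), hker'] at hpos
  simp only [mulVec_zero, dotProduct_zero, zero_dotProduct, add_zero, sub_zero] at hpos
  linarith

/-- Lyapunov-type comparison lemma: if `K' ⪰ ÃK + KÃᵀ` on `[t₀,∞)` (with `Ã`
continuous on `[t₀,∞)`, `K` symmetric-valued and differentiable entrywise) and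
`K(t₀) ⪰ 0`, then `K(t) ⪰ 0` for all `t ≥ t₀`. -/
theorem lyapunov_psd_invariance {n : ℕ} (t₀ : ℝ)
    (Atil K K' : ℝ → Matrix (Fin n) (Fin n) ℝ)
    (hAcont : ∀ i j, ContinuousOn (fun t => Atil t i j) (Set.Ici t₀))
    (hKderiv : ∀ t ∈ Set.Ici t₀, ∀ i j, HasDerivAt (fun s => K s i j) (K' t i j) t)
    (hKsym : ∀ t ∈ Set.Ici t₀, (K t).IsSymm)
    (hineq : ∀ t ∈ Set.Ici t₀,
      (K' t - (Atil t * K t + K t * (Atil t)ᵀ)).PosSemidef)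
    (h0 : (K t₀).PosSemidef) :
    ∀ t ∈ Set.Ici t₀, (K t).PosSemidef := by
  intro T hT
  obtain ⟨M, hM⟩ := (isCompact_Icc (a := t₀) (b := T)).bddAbove_image
    (f := fun t => ∑ i, ∑ j, |Atil t i j|) <| by
      exact continuousOn_finsetSum _ fun i _ => continuousOn_finsetSum _ fun j _ =>
        ((hAcont i j).mono Set.Icc_subset_Ici_self).abs
  replace hM : ∀ t ∈ Set.Icc t₀ T, ∑ i, ∑ j, |Atil t i j| ≤ M := fun t ht =>
    hM (Set.mem_image_of_mem _ ht)
  let c := 2 * M + 1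
  let e : ℝ → ℝ := fun t => Real.exp (c * (t - t₀))
  have he : ∀ t, 0 < e t := fun t => Real.exp_pos _
  have he' : ∀ t, HasDerivAt e (c * e t) t := fun t => by
    have := ((((hasDerivAt_id t).sub_const t₀).const_mul c).exp)
    simpa [e, mul_comm] using this
  have hself : ∀ {v : Fin n → ℝ}, v ≠ 0 → 0 < v ⬝ᵥ v := fun {v} hv => by
    simpa using dotProduct_star_self_pos_iff.2 hv
  have key : ∀ ε > 0, (K T + (ε * e T) • (1 : Matrix (Fin n) (Fin n) ℝ)).PosDef := by
    intro ε hε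
    refine PosDef.of_lyapunov_lt (a := t₀) (b := T) (A := Atil)
      (K := fun t => K t + (ε * e t) • (1 : Matrix (Fin n) (Fin n) ℝ))
      (K' := fun t => K' t + (ε * (c * e t)) • (1 : Matrix (Fin n) (Fin n) ℝ))
      ?_ ?_ ?_ ?_ T ⟨hT, le_rfl⟩
    · intro t ht i j
      exact (hKderiv t ht.1 i j).add (((he' t).const_mul ε).mul_const _)
    · intro t ht
      exact (hKsym t ht.1).add (isSymm_one.smul _)
    · intro t ht
      have hsplit : K' t + (ε * (c * e t)) • (1 : Matrix (Fin n) (Fin n) ℝ) -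
          (Atil t * (K t + (ε * e t) • (1 : Matrix (Fin n) (Fin n) ℝ)) +
            (K t + (ε * e t) • (1 : Matrix (Fin n) (Fin n) ℝ)) * (Atil t)ᵀ) =
          (K' t - (Atil t * K t + K t * (Atil t)ᵀ)) +
            (ε * e t) • (c • (1 : Matrix (Fin n) (Fin n) ℝ) - (Atil t + (Atil t)ᵀ)) := by
        simp only [mul_add, add_mul, Matrix.mul_smul, Matrix.smul_mul, mul_one, one_mul]
        module
      rw [hsplit]
      refine PosDef.posSemidef_add (hineq t ht.1) (PosDef.smul ?_ (mul_pos hε (he t)))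
      refine .of_dotProduct_mulVec_pos ?_ fun v hv => ?_
      · simp [IsHermitian, conjTranspose_eq_transpose_of_trivial, add_comm]
      · have hA := dotProduct_mulVec_le_sum_abs (Atil t) v
        have hvv := hself hv
        have hMv := mul_le_mul_of_nonneg_right (hM t ht) hvv.le
        have hT : v ⬝ᵥ (Atil t)ᵀ *ᵥ v = v ⬝ᵥ Atil t *ᵥ v := by
          rw [mulVec_transpose, dotProduct_comm, dotProduct_mulVec]
        simp only [star_trivial, sub_mulVec, add_mulVec, smul_mulVec, one_mulVec, dotProduct_sub,
          dotProduct_add, dotProduct_smul, smul_eq_mul, hT, c]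
        linarith
    · exact PosDef.posSemidef_add h0 (PosDef.one.smul (mul_pos hε (he t₀)))
  refine .of_dotProduct_mulVec_nonneg (by simpa using! hKsym T hT) fun v => ?_
  have hlim : Filter.Tendsto (fun ε : ℝ => v ⬝ᵥ K T *ᵥ v + ε * e T * (v ⬝ᵥ v))
      (nhdsWithin 0 (Set.Ioi 0)) (nhds (v ⬝ᵥ K T *ᵥ v)) := by
    have : Continuous fun ε : ℝ => v ⬝ᵥ K T *ᵥ v + ε * e T * (v ⬝ᵥ v) := by fun_prop
    simpa using (this.tendsto 0).mono_left (nhdsWithin_le_nhds (s := Set.Ioi 0))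
  refine ge_of_tendsto hlim ?_
  filter_upwards [self_mem_nhdsWithin] with ε hε
  simpa [add_mulVec, smul_mulVec, dotProduct_add] using
    (key ε hε).posSemidef.dotProduct_mulVec_nonneg v
end

section
/- Let A be a real n×n matrix, Q and G symmetric positive semidefinite n×n matrices, and define the continuous-time Riccati operator R_G(Σ) := AΣ + ΣAᵀ + Q − ΣGΣ. Let Σ̄, Δ : [t₀,∞) → ℝ^{n×n} be differentiable functions taking symmetric values such that: (i) for every t ≥ t₀ the matrix R_G(Σ̄(t)) − Σ̄'(t) is positive semidefinite; (ii) Δ'(t) = R_G(Δ(t)) for every t ≥ t₀; and (iii) Δ(t₀) = Σ̄(t₀). Then Δ(t) − Σ̄(t) is positive semidefinite for every t ≥ t₀. -/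
open Matrix

/-- The continuous-time Riccati operator `R_G(Σ) = AΣ + ΣAᵀ + Q − ΣGΣ`. -/
noncomputable def riccatiC {n : ℕ} (A Q G : Matrix (Fin n) (Fin n) ℝ)
    (X : Matrix (Fin n) (Fin n) ℝ) : Matrix (Fin n) (Fin n) ℝ :=
  A * X + X * Aᵀ + Q - X * G * X

/-- A quadratic form that is nonnegative on the unit sphere comes from a positive semidefinite
matrix. -/
theorem posSemidef_of_unit_nonneg {n : ℕ} {M : Matrix (Fin n) (Fin n) ℝ} (hM : M.IsSymm)
    (h : ∀ v : Fin n → ℝ, v ⬝ᵥ v = 1 → 0 ≤ v ⬝ᵥ M *ᵥ v) : M.PosSemidef := by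
  refine Matrix.PosSemidef.of_dotProduct_mulVec_nonneg
    (by rw [Matrix.IsHermitian, conjTranspose_eq_transpose_of_trivial]; exact hM) fun v => ?_
  rw [star_trivial]
  by_cases hv : v = 0
  · simp [hv]
  have hpos : 0 < v ⬝ᵥ v := lt_of_le_of_ne
    (Finset.sum_nonneg fun i _ => mul_self_nonneg (v i))
    fun h0 => hv (dotProduct_self_eq_zero.mp h0.symm)
  set r := Real.sqrt (v ⬝ᵥ v)
  have hr : 0 < r := Real.sqrt_pos.mpr hpos
  have hrr : r * r = v ⬝ᵥ v := Real.mul_self_sqrt hpos.le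
  have hu := h (r⁻¹ • v) (by
    rw [smul_dotProduct, dotProduct_smul, ← hrr]
    simp only [smul_eq_mul]
    field_simp)
  rw [mulVec_smul, smul_dotProduct, dotProduct_smul, smul_eq_mul, smul_eq_mul, ← mul_assoc] at hu
  exact nonneg_of_mul_nonneg_right hu (by positivity)

theorem isCompact_unit_dotProduct (n : ℕ) : IsCompact {v : Fin n → ℝ | v ⬝ᵥ v = 1} := by
  refine Metric.isCompact_of_isClosed_isBounded
    (isClosed_eq (Continuous.dotProduct continuous_id continuous_id) continuous_const)
    ((Metric.isBounded_closedBall (x := (0 : Fin n → ℝ)) (r := 1)).subset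
      fun v (hv : v ⬝ᵥ v = 1) => ?_)
  rw [mem_closedBall_zero_iff, pi_norm_le_iff_of_nonneg zero_le_one]
  intro i
  have h1 : v i * v i ≤ v ⬝ᵥ v :=
    Finset.single_le_sum (f := fun i => v i * v i) (fun j _ => mul_self_nonneg (v j))
      (Finset.mem_univ i)
  rw [hv] at h1
  rw [Real.norm_eq_abs]
  exact abs_le_one_iff_mul_self_le_one.mpr h1

theorem hasDerivAt_dotProduct_mulVec {n : ℕ} {D : ℝ → Matrix (Fin n) (Fin n) ℝ}
    {D' : Matrix (Fin n) (Fin n) ℝ} {t : ℝ}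
    (hD : ∀ i j, HasDerivAt (fun s => D s i j) (D' i j) t) (v : Fin n → ℝ) :
    HasDerivAt (fun s => v ⬝ᵥ D s *ᵥ v) (v ⬝ᵥ D' *ᵥ v) t := by
  simp only [dotProduct, mulVec]
  exact HasDerivAt.fun_sum fun i _ =>
    (HasDerivAt.fun_sum fun j _ => (hD i j).mul_const (v j)).const_mul (v i)

/-- A function that is nonnegative to the left of one of its zeros has nonpositive derivative
there. -/
theorem deriv_nonpos_of_nonneg_left {f : ℝ → ℝ} {f' a t : ℝ} (hat : a < t)
    (hf : HasDerivAt f f' t) (h0 : f t ≤ 0) (h : ∀ s ∈ Set.Ico a t, 0 ≤ f s) : f' ≤ 0 := by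
  have hs := (hasDerivAt_iff_tendsto_slope.mp hf).mono_left (nhdsLT_le_nhdsNE t)
  refine le_of_tendsto hs ?_
  filter_upwards [Ico_mem_nhdsLT hat] with s hs
  rw [slope_def_field]
  exact div_nonpos_of_nonneg_of_nonpos (by linarith [h s hs]) (by linarith [hs.2])

/-- Solutions of the Lyapunov differential equation `D' = FD + DFᵀ + P` with `P ⪰ 0` stay positive
semidefinite. -/
theorem posSemidef_of_lyapunov {n : ℕ} {a b : ℝ} (hab : a ≤ b)
    {D F P : ℝ → Matrix (Fin n) (Fin n) ℝ}
    (hF : ContinuousOn F (Set.Icc a b))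
    (hD : ∀ t ∈ Set.Icc a b, ∀ i j,
      HasDerivAt (fun s => D s i j) ((F t * D t + D t * (F t)ᵀ + P t) i j) t)
    (hsymm : ∀ t ∈ Set.Icc a b, (D t).IsSymm)
    (hP : ∀ t ∈ Set.Icc a b, (P t).PosSemidef)
    (hinit : (D a).PosSemidef) : (D b).PosSemidef := by
  have hDc : ContinuousOn D (Set.Icc a b) := continuousOn_pi.mpr fun i =>
    continuousOn_pi.mpr fun j t ht => (hD t ht i j).continuousAt.continuousWithinAt
  have hcomp := isCompact_Icc (a := a) (b := b) |>.prod (isCompact_unit_dotProduct n)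
  have hquad : ∀ {M : ℝ → Matrix (Fin n) (Fin n) ℝ}, ContinuousOn M (Set.Icc a b) →
      ContinuousOn (fun p : ℝ × (Fin n → ℝ) => p.2 ⬝ᵥ M p.1 *ᵥ p.2)
        (Set.Icc a b ×ˢ {v : Fin n → ℝ | v ⬝ᵥ v = 1}) := by
    intro M hM
    have h1 : ContinuousOn (fun p : ℝ × (Fin n → ℝ) => M p.1)
        (Set.Icc a b ×ˢ {v : Fin n → ℝ | v ⬝ᵥ v = 1}) :=
      hM.comp continuousOn_fst fun p hp => hp.1
    have h2 : Continuous fun q : Matrix (Fin n) (Fin n) ℝ × (Fin n → ℝ) =>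
        q.2 ⬝ᵥ q.1 *ᵥ q.2 :=
      continuous_snd.dotProduct (continuous_fst.matrix_mulVec continuous_snd)
    exact h2.comp_continuousOn (h1.prodMk continuousOn_snd)
  obtain ⟨K, hK⟩ := hcomp.bddAbove_image (hquad hF)
  have hK : ∀ t ∈ Set.Icc a b, ∀ v : Fin n → ℝ, v ⬝ᵥ v = 1 → v ⬝ᵥ F t *ᵥ v ≤ K :=
    fun t ht v hv => hK ⟨(t, v), ⟨ht, hv⟩, rfl⟩
  set L := 2 * K + 1 with hL
  have key : ∀ ε > 0, ∀ t ∈ Set.Icc a b, ∀ v : Fin n → ℝ, v ⬝ᵥ v = 1 →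
      0 < v ⬝ᵥ D t *ᵥ v + ε * Real.exp (L * t) := by
    intro ε hε
    by_contra! hne
    obtain ⟨t₁, ht₁, v₁, hv₁, hneg₁⟩ := hne
    have hqc : ContinuousOn
        (fun p : ℝ × (Fin n → ℝ) => p.2 ⬝ᵥ D p.1 *ᵥ p.2 + ε * Real.exp (L * p.1))
        (Set.Icc a b ×ˢ {v : Fin n → ℝ | v ⬝ᵥ v = 1}) :=
      (hquad hDc).add (by fun_prop)
    have hbad := hcomp.of_isClosed_subset
      (hqc.preimage_isClosed_of_isClosed hcomp.isClosed isClosed_Iic (t := Set.Iic 0))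
      Set.inter_subset_left
    obtain ⟨⟨t, v⟩, ⟨⟨ht, hv⟩, hneg⟩, hmin⟩ :=
      hbad.exists_isMinOn ⟨(t₁, v₁), ⟨ht₁, hv₁⟩, hneg₁⟩ continuousOn_fst
    simp only [Set.mem_ofPred_eq, Set.mem_preimage, Set.mem_Iic] at ht hv hneg
    have hbefore : ∀ s ∈ Set.Ico a t, ∀ u : Fin n → ℝ, u ⬝ᵥ u = 1 →
        0 < u ⬝ᵥ D s *ᵥ u + ε * Real.exp (L * s) := by
      intro s hs u hu
      by_contra! hle
      exact absurd (hmin (a := (s, u)) ⟨⟨⟨hs.1, hs.2.le.trans ht.2⟩, hu⟩, hle⟩) (not_le.mpr hs.2)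
    have hat : a < t := by
      refine lt_of_le_of_ne ht.1 fun h => ?_
      subst h
      have h1 := hinit.dotProduct_mulVec_nonneg v
      rw [star_trivial] at h1
      have := Real.exp_pos (L * a)
      nlinarith [mul_pos hε this]
    have hderiv : ∀ u : Fin n → ℝ,
        HasDerivAt (fun s => u ⬝ᵥ D s *ᵥ u + ε * Real.exp (L * s))
          (u ⬝ᵥ (F t * D t + D t * (F t)ᵀ + P t) *ᵥ u + ε * (Real.exp (L * t) * L)) t := by
      intro u
      refine (hasDerivAt_dotProduct_mulVec (hD t ht) u).add (HasDerivAt.const_mul ε ?_)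
      simpa using ((hasDerivAt_id t).const_mul L).exp
    set c := ε * Real.exp (L * t) with hc
    have hcpos : 0 < c := mul_pos hε (Real.exp_pos _)
    have hform : ∀ u : Fin n → ℝ, u ⬝ᵥ (D t + c • (1 : Matrix (Fin n) (Fin n) ℝ)) *ᵥ u
        = u ⬝ᵥ D t *ᵥ u + c * (u ⬝ᵥ u) := by
      intro u
      rw [add_mulVec, dotProduct_add, smul_mulVec, one_mulVec, dotProduct_smul, smul_eq_mul]
    have hE : (D t + c • (1 : Matrix (Fin n) (Fin n) ℝ)).PosSemidef := by
      refine posSemidef_of_unit_nonneg ((hsymm t ht).add (isSymm_one.smul c)) fun u hu => ?_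
      rw [hform, hu, mul_one]
      refine ge_of_tendsto ((hderiv u).continuousAt.tendsto.mono_left
        (nhdsWithin_le_nhds (s := Set.Iio t))) ?_
      filter_upwards [Ico_mem_nhdsLT hat] with s hs using (hbefore s hs u hu).le
    have hEv : (D t + c • (1 : Matrix (Fin n) (Fin n) ℝ)) *ᵥ v = 0 := by
      refine (hE.dotProduct_mulVec_zero_iff v).mp (le_antisymm ?_ (hE.dotProduct_mulVec_nonneg v))
      rw [star_trivial, hform, hv, mul_one]
      exact hneg
    have hDv : D t *ᵥ v = -(c • v) := by
      rw [add_mulVec, smul_mulVec, one_mulVec] at hEv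
      exact eq_neg_of_add_eq_zero_left hEv
    have hvD : v ᵥ* D t = -(c • v) := by
      rw [← hDv, ← vecMul_transpose, (hsymm t ht).eq]
    have hval : v ⬝ᵥ (F t * D t + D t * (F t)ᵀ + P t) *ᵥ v
        = -(2 * c * (v ⬝ᵥ F t *ᵥ v)) + v ⬝ᵥ P t *ᵥ v := by
      have h1 : v ⬝ᵥ (F t * D t) *ᵥ v = -(c * (v ⬝ᵥ F t *ᵥ v)) := by
        rw [← mulVec_mulVec, hDv, mulVec_neg, mulVec_smul, dotProduct_neg, dotProduct_smul,
          smul_eq_mul]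
      have h2 : v ⬝ᵥ (D t * (F t)ᵀ) *ᵥ v = -(c * (v ⬝ᵥ F t *ᵥ v)) := by
        rw [← mulVec_mulVec, dotProduct_mulVec, hvD, neg_dotProduct, smul_dotProduct, smul_eq_mul,
          mulVec_transpose, dotProduct_comm, ← dotProduct_mulVec]
      rw [add_mulVec, add_mulVec, dotProduct_add, dotProduct_add, h1, h2]
      ring
    have hle := deriv_nonpos_of_nonneg_left hat (hderiv v) hneg
      fun s hs => (hbefore s hs v hv).le
    have hPv := (hP t ht).dotProduct_mulVec_nonneg v
    rw [star_trivial] at hPv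
    rw [hval, ← mul_assoc ε, ← hc, hL] at hle
    nlinarith [mul_le_mul_of_nonneg_left (hK t ht v hv) hcpos.le]
  have hb : b ∈ Set.Icc a b := Set.right_mem_Icc.mpr hab
  refine posSemidef_of_unit_nonneg (hsymm b hb) fun v hv => ?_
  refine le_of_forall_pos_le_add fun δ hδ => ?_
  have h := key (δ / Real.exp (L * b)) (div_pos hδ (Real.exp_pos _)) b hb v hv
  rw [div_mul_cancel₀ _ (Real.exp_pos _).ne'] at h
  exact h.le

/-- Deterministic comparison principle for the Riccati differential equation:
any symmetric trajectory `Σ̄` satisfying the differential inequality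
`Σ̄' ⪯ R_G(Σ̄)` is dominated, in the Loewner order, by the solution `Δ` of
`Δ' = R_G(Δ)` started from the same initial condition. -/
theorem riccatiC_comparison {n : ℕ} (t₀ : ℝ) (A Q G : Matrix (Fin n) (Fin n) ℝ)
    (hQ : Q.PosSemidef) (hG : G.PosSemidef)
    (Sbar Δ Sbar' Δ' : ℝ → Matrix (Fin n) (Fin n) ℝ)
    (hSderiv : ∀ t ∈ Set.Ici t₀, ∀ i j,
      HasDerivAt (fun s => Sbar s i j) (Sbar' t i j) t)
    (hDderiv : ∀ t ∈ Set.Ici t₀, ∀ i j,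
      HasDerivAt (fun s => Δ s i j) (Δ' t i j) t)
    (hSsym : ∀ t ∈ Set.Ici t₀, (Sbar t).IsSymm)
    (hDsym : ∀ t ∈ Set.Ici t₀, (Δ t).IsSymm)
    (hineq : ∀ t ∈ Set.Ici t₀, (riccatiC A Q G (Sbar t) - Sbar' t).PosSemidef)
    (heq : ∀ t ∈ Set.Ici t₀, Δ' t = riccatiC A Q G (Δ t))
    (hinit : Δ t₀ = Sbar t₀) :
    ∀ t ∈ Set.Ici t₀, (Δ t - Sbar t).PosSemidef := by
  intro b hb
  have hmem : ∀ t ∈ Set.Icc t₀ b, t ∈ Set.Ici t₀ := fun t ht => ht.1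
  have hcont : ∀ {M M' : ℝ → Matrix (Fin n) (Fin n) ℝ}, (∀ t ∈ Set.Ici t₀, ∀ i j,
      HasDerivAt (fun s => M s i j) (M' t i j) t) → ContinuousOn M (Set.Icc t₀ b) :=
    fun h => continuousOn_pi.mpr fun i => continuousOn_pi.mpr fun j t ht =>
      (h t (hmem t ht) i j).continuousAt.continuousWithinAt
  refine posSemidef_of_lyapunov (a := t₀) (D := fun t => Δ t - Sbar t)
    (F := fun t => A - (2⁻¹ : ℝ) • ((Δ t + Sbar t) * G))
    (P := fun t => riccatiC A Q G (Sbar t) - Sbar' t) hb ?_ ?_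
    (fun t ht => (hDsym t ht.1).sub (hSsym t ht.1)) (fun t ht => hineq t ht.1) ?_
  · have hlin : Continuous fun X : Matrix (Fin n) (Fin n) ℝ => A - (2⁻¹ : ℝ) • (X * G) := by
      fun_prop
    exact hlin.comp_continuousOn ((hcont hDderiv).add (hcont hSderiv))
  · intro t ht i j
    have hGt : Gᵀ = G := by
      rw [← conjTranspose_eq_transpose_of_trivial]
      exact hG.isHermitian
    have hval : (A - (2⁻¹ : ℝ) • ((Δ t + Sbar t) * G)) * (Δ t - Sbar t)
        + (Δ t - Sbar t) * (A - (2⁻¹ : ℝ) • ((Δ t + Sbar t) * G))ᵀ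
        + (riccatiC A Q G (Sbar t) - Sbar' t) = Δ' t - Sbar' t := by
      rw [heq t ht.1, transpose_sub, transpose_smul, transpose_mul, transpose_add,
        (hDsym t ht.1).eq, (hSsym t ht.1).eq, hGt]
      simp only [riccatiC, sub_mul, mul_sub, add_mul, mul_add, smul_mul_assoc, mul_smul_comm,
        smul_add, ← mul_assoc]
      module
    simp only [hval, Matrix.sub_apply]
    exact (hDderiv t ht.1 i j).sub (hSderiv t ht.1 i j)
  · simpa [hinit] using Matrix.PosSemidef.zero
end

section
/- Let a < 0 and q_c > 0 be real numbers, let n ≥ 1, and let Ḡ be a symmetric positive definite real n×n matrix. Let S denote the (unique) positive semidefinite square root of the positive definite matrix a²·I + q_c·Ḡ. Then the matrix a·I − S is invertible, and the matrix Δ∞ := −q_c·(a·I − S)⁻¹ is symmetric positive definite and satisfies the continuous-time algebraic Riccati equation 2a·Δ∞ + q_c·I − Δ∞·Ḡ·Δ∞ = 0. -/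
open Matrix

/-- If `S * S = a² I + q G` and `a I - S` is invertible, then `-q (a I - S)⁻¹` solves the
Riccati equation with drift `a I`, noise intensity `q I` and information matrix `G`. -/
theorem riccati_eq_zero_of_mul_self_eq {m R : Type*} [Fintype m] [DecidableEq m] [CommRing R]
    {a q : R} {G S : Matrix m m R}
    (hS : S * S = a ^ 2 • (1 : Matrix m m R) + q • G)
    (hM : IsUnit (a • (1 : Matrix m m R) - S)) :
    (2 * a) • ((-q) • (a • (1 : Matrix m m R) - S)⁻¹) + q • (1 : Matrix m m R)
      - ((-q) • (a • (1 : Matrix m m R) - S)⁻¹) * G *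
        ((-q) • (a • (1 : Matrix m m R) - S)⁻¹) = 0 := by
  have hdet := (Matrix.isUnit_iff_isUnit_det _).mp hM
  set M := a • (1 : Matrix m m R) - S with hMdef
  have hqG : q • G = M * M - (2 * a) • M := by
    rw [← add_right_inj (a ^ 2 • (1 : Matrix m m R)), ← hS, hMdef]
    simp only [sub_mul, mul_sub, smul_mul_assoc, mul_smul_comm, one_mul, mul_one]
    module
  have hsandwich : M⁻¹ * (q • G) * M⁻¹ = 1 - (2 * a) • M⁻¹ := by
    rw [hqG, mul_sub, Matrix.nonsing_inv_mul_cancel_left _ _ hdet, mul_smul_comm,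
      Matrix.nonsing_inv_mul _ hdet, sub_mul, Matrix.mul_nonsing_inv _ hdet, smul_mul_assoc,
      one_mul]
  have hquad : ((-q) • M⁻¹) * G * ((-q) • M⁻¹) = q • (M⁻¹ * (q • G) * M⁻¹) := by
    simp only [smul_mul_assoc, mul_smul_comm]
    module
  rw [hquad, hsandwich]
  module

/-- Closed form of the steady-state solution of the continuous-time algebraic
Riccati equation with isotropic drift `aI` (`a < 0`) and process-noise
intensity `q_c·I` (`q_c > 0`): with `S` the positive semidefinite square root
of `a²I + q_c Ḡ`, the matrix `aI − S` is invertible and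
`Δ∞ = −q_c (aI − S)⁻¹` is symmetric positive definite and satisfies
`2a Δ∞ + q_c I − Δ∞ Ḡ Δ∞ = 0`. -/
theorem care_closed_form {n : ℕ} (hn : 1 ≤ n) (a q_c : ℝ)
    (ha : a < 0) (hq : 0 < q_c)
    (G S : Matrix (Fin n) (Fin n) ℝ) (hG : G.PosDef)
    (hS : S.PosSemidef)
    (hS2 : S * S = a ^ 2 • (1 : Matrix (Fin n) (Fin n) ℝ) + q_c • G) :
    IsUnit (a • (1 : Matrix (Fin n) (Fin n) ℝ) - S) ∧
    ((-q_c) • (a • (1 : Matrix (Fin n) (Fin n) ℝ) - S)⁻¹).PosDef ∧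
    (2 * a) • ((-q_c) • (a • (1 : Matrix (Fin n) (Fin n) ℝ) - S)⁻¹)
      + q_c • (1 : Matrix (Fin n) (Fin n) ℝ)
      - ((-q_c) • (a • (1 : Matrix (Fin n) (Fin n) ℝ) - S)⁻¹) * G *
        ((-q_c) • (a • (1 : Matrix (Fin n) (Fin n) ℝ) - S)⁻¹) = 0 := by
  have hN : (S - a • (1 : Matrix (Fin n) (Fin n) ℝ)).PosDef := by
    rw [sub_eq_add_neg, ← neg_smul]
    exact Matrix.PosDef.posSemidef_add hS (Matrix.PosDef.one.smul (neg_pos.mpr ha))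
  have hM : IsUnit (a • (1 : Matrix (Fin n) (Fin n) ℝ) - S) := by
    rw [← neg_sub]
    exact hN.isUnit.neg
  refine ⟨hM, ?_, riccati_eq_zero_of_mul_self_eq hS2 hM⟩
  have hinv : (a • (1 : Matrix (Fin n) (Fin n) ℝ) - S)⁻¹ =
      -(S - a • (1 : Matrix (Fin n) (Fin n) ℝ))⁻¹ := by
    apply Matrix.inv_eq_right_inv
    rw [← neg_sub S, neg_mul_neg,
      Matrix.mul_nonsing_inv _ ((Matrix.isUnit_iff_isUnit_det _).mp hN.isUnit)]
  rw [hinv, neg_smul_neg]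
  exact hN.inv.smul hq
end

section
/- Let Σ and Δ be symmetric real n×n matrices with Σ positive semidefinite and Δ − Σ positive semidefinite, and let M be any real m×n matrix with m ≥ 1. Define Π := M·Σ·Mᵀ and Δ^Π := M·Δ·Mᵀ. Then (1/m)·∑_{i=1}^{m} 1/(1 + Π_ii) ≥ 1/(1 + (1/m)·tr(Δ^Π)). -/
open Matrix

/-- The arithmetic-harmonic mean inequality for the numbers `1 + a i`, weakened by
replacing the sum of the `a i` with an upper bound. -/
theorem one_div_one_add_mean_le_mean_one_div {m : ℕ} (hm : 1 ≤ m) (a : Fin m → ℝ)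
    (ha : ∀ i, 0 ≤ a i) {t : ℝ} (ht : ∑ i, a i ≤ t) :
    1 / (1 + (1 / (m : ℝ)) * t) ≤ (1 / (m : ℝ)) * ∑ i, 1 / (1 + a i) := by
  have hm0 : (0 : ℝ) < m := by exact_mod_cast hm
  have hsum : 0 ≤ ∑ i, a i := Finset.sum_nonneg fun i _ => ha i
  have hcs := Finset.sq_sum_div_le_sum_sq_div (Finset.univ : Finset (Fin m))
    (fun _ => (1 : ℝ)) (g := fun i => 1 + a i) fun i _ => by linarith [ha i]
  simp only [Finset.sum_add_distrib, Finset.sum_const, Finset.card_univ, Fintype.card_fin,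
    nsmul_eq_mul, mul_one, one_pow] at hcs
  calc 1 / (1 + (1 / (m : ℝ)) * t)
      ≤ 1 / (1 + (1 / (m : ℝ)) * ∑ i, a i) := by gcongr
    _ = (1 / (m : ℝ)) * ((m : ℝ) ^ 2 / (m + ∑ i, a i)) := by
      field_simp
    _ ≤ (1 / (m : ℝ)) * ∑ i, 1 / (1 + a i) := by gcongr

/-- Lower bound on the spatially averaged clarity in terms of the covariance
upper bound: if `0 ⪯ Σ ⪯ Δ` and `Π = MΣMᵀ`, `Δ^Π = MΔMᵀ`, then
`(1/m) ∑ᵢ 1/(1 + Πᵢᵢ) ≥ 1/(1 + (1/m) tr(Δ^Π))`. -/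
theorem averaged_clarity_lower_bound {n m : ℕ} (hm : 1 ≤ m)
    (Sg Δ : Matrix (Fin n) (Fin n) ℝ)
    (hSg : Sg.PosSemidef) (hΔsym : Δ.IsSymm) (hle : (Δ - Sg).PosSemidef)
    (M : Matrix (Fin m) (Fin n) ℝ) :
    (1 / (m : ℝ)) * ∑ i, 1 / (1 + (M * Sg * Mᵀ) i i)
      ≥ 1 / (1 + (1 / (m : ℝ)) * (M * Δ * Mᵀ).trace) := by
  have hPi := hSg.mul_mul_conjTranspose_same M
  have hdiff := (hle.mul_mul_conjTranspose_same M).trace_nonneg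
  rw [conjTranspose_eq_transpose_of_trivial] at hPi hdiff
  rw [Matrix.mul_sub, Matrix.sub_mul, trace_sub, sub_nonneg] at hdiff
  exact one_div_one_add_mean_le_mean_one_div hm _ (fun _ => hPi.diag_nonneg) hdiff
end

section
/- Let N_g ≥ 1 and N_r ≥ 0 be natural numbers, let K be a symmetric positive definite real N_g×N_g matrix with positive semidefinite square root K^{1/2}, let C be a real N_g×p matrix, and let σ_m > 0 and Δt > 0 be real numbers. For a function j : {1,…,N_r} → {1,…,N_g}, let S_j be the N_g×N_r matrix whose i-th column is the standard basis vector e_{j(i)}, and define H_j := S_jᵀ·K·K⁻¹·K^{1/2}·C and V := Δt·σ_m²·I_{N_r}. Then the uniform average over all N_g^{N_r} such functions satisfies (1/N_g^{N_r})·∑_j H_jᵀ·V⁻¹·H_j = (N_r/(σ_m²·Δt))·Cᵀ·(K/N_g)·C. -/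
open Matrix

/-- The column-selector matrix of a placement `j : Fin Nr → Fin Ng`: its
`i`-th column is the standard basis vector `e_{j i}`. -/
def selMat {Ng Nr : ℕ} (j : Fin Nr → Fin Ng) : Matrix (Fin Ng) (Fin Nr) ℝ :=
  Matrix.of fun r c => if r = j c then 1 else 0

/-- Evaluating at a fixed coordinate, a sum over all functions `Fin n → Fin m` counts each value
`m ^ (n - 1)` times; the exponent is cleared by multiplying by `m`. -/
theorem card_mul_sum_apply {m n : ℕ} (f : Fin m → ℝ) (i : Fin n) :
    (m : ℝ) * ∑ j : Fin n → Fin m, f (j i) = (m : ℝ) ^ n * ∑ b, f b := by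
  have h := Fintype.sum_piFinset_apply f Finset.univ i
  rw [Fintype.piFinset_univ] at h
  have hn : n - 1 + 1 = n := Nat.sub_add_cancel i.pos
  rw [h, Finset.card_univ, Fintype.card_fin, Fintype.card_fin, nsmul_eq_mul, Nat.cast_pow,
    ← mul_assoc, ← pow_succ', hn]

theorem card_smul_sum_selMat_mul_transpose (Ng Nr : ℕ) :
    (Ng : ℝ) • ∑ j : Fin Nr → Fin Ng, selMat j * (selMat j)ᵀ =
      ((Ng : ℝ) ^ Nr * Nr) • (1 : Matrix (Fin Ng) (Fin Ng) ℝ) := by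
  ext r s
  have h (i : Fin Nr) := card_mul_sum_apply
    (fun x : Fin Ng => (if r = x then (1 : ℝ) else 0) * if s = x then 1 else 0) i
  simp only [Matrix.smul_apply, Matrix.sum_apply, mul_apply, selMat, transpose_apply, of_apply,
    smul_eq_mul]
  rw [Finset.sum_comm, Finset.mul_sum, Finset.sum_congr rfl fun i _ => h i]
  simp only [Finset.sum_const, Finset.card_univ, Fintype.card_fin, nsmul_eq_mul, one_apply,
    ite_mul, one_mul, zero_mul, Finset.sum_ite_eq, Finset.mem_univ, if_true, eq_comm (a := s)]
  ring

/-- Closed form of the averaged information matrix: averaging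
`Hⱼᵀ V⁻¹ Hⱼ` with `Hⱼ = Sⱼᵀ K K⁻¹ K^{1/2} C` and `V = Δt σ_m² I` over all
uniform sensor placements `j` gives `(Nr/(σ_m² Δt)) · Cᵀ (K/Ng) C`. -/
theorem averaged_information_matrix {Ng Nr p : ℕ} (hNg : 1 ≤ Ng)
    (K Ksq : Matrix (Fin Ng) (Fin Ng) ℝ) (hK : K.PosDef)
    (hKsq : Ksq.PosSemidef) (hKsq2 : Ksq * Ksq = K)
    (C : Matrix (Fin Ng) (Fin p) ℝ) (σm Δt : ℝ) (hσ : 0 < σm) (hΔt : 0 < Δt) :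
    ((1 : ℝ) / (Ng : ℝ) ^ Nr) •
        ∑ j : Fin Nr → Fin Ng,
          ((selMat j)ᵀ * K * K⁻¹ * Ksq * C)ᵀ *
            ((Δt * σm ^ 2) • (1 : Matrix (Fin Nr) (Fin Nr) ℝ))⁻¹ *
            ((selMat j)ᵀ * K * K⁻¹ * Ksq * C)
      = ((Nr : ℝ) / (σm ^ 2 * Δt)) •
          (Cᵀ * (((1 : ℝ) / (Ng : ℝ)) • K) * C) := by
  have hN : (Ng : ℝ) ≠ 0 := by positivity
  have hc : Δt * σm ^ 2 ≠ 0 := by positivity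
  have hV : ((Δt * σm ^ 2) • (1 : Matrix (Fin Nr) (Fin Nr) ℝ))⁻¹ =
      (Δt * σm ^ 2)⁻¹ • (1 : Matrix (Fin Nr) (Fin Nr) ℝ) :=
    inv_eq_left_inv (by rw [Matrix.smul_mul, Matrix.one_mul, inv_smul_smul₀ hc])
  have hKsqT : Ksqᵀ = Ksq := by simpa using hKsq.isHermitian.eq
  have hterm (j : Fin Nr → Fin Ng) :
      ((selMat j)ᵀ * K * K⁻¹ * Ksq * C)ᵀ *
          ((Δt * σm ^ 2) • (1 : Matrix (Fin Nr) (Fin Nr) ℝ))⁻¹ *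
          ((selMat j)ᵀ * K * K⁻¹ * Ksq * C) =
        (Δt * σm ^ 2)⁻¹ • (Cᵀ * Ksq * (selMat j * (selMat j)ᵀ) * (Ksq * C)) := by
    rw [hV, mul_nonsing_inv_cancel_right _ _ ((isUnit_iff_isUnit_det K).mp hK.isUnit)]
    simp only [transpose_mul, transpose_transpose, hKsqT, Matrix.mul_smul, Matrix.smul_mul,
      Matrix.mul_one, Matrix.mul_assoc]
  have hsum : ∑ j : Fin Nr → Fin Ng, selMat j * (selMat j)ᵀ =
      ((Ng : ℝ)⁻¹ * ((Ng : ℝ) ^ Nr * Nr)) • (1 : Matrix (Fin Ng) (Fin Ng) ℝ) := by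
    rw [mul_smul, ← card_smul_sum_selMat_mul_transpose, inv_smul_smul₀ hN]
  rw [Finset.sum_congr rfl fun j _ => hterm j, ← Finset.smul_sum, ← Matrix.sum_mul,
    ← Matrix.mul_sum, hsum, ← hKsq2]
  simp only [Matrix.mul_smul, Matrix.smul_mul, Matrix.mul_one, Matrix.mul_assoc, smul_smul]
  congr 1
  field_simp
end

section
/- Let Φ be a real n×n matrix and Q_d a symmetric positive semidefinite n×n matrix. For each i in a finite index set of size N, let H_i be a real m_i×n matrix and V_i a symmetric positive definite m_i×m_i matrix, and define the discrete-time Riccati operator R_i(Σ) := Φ·Σ·Φᵀ + Q_d − Φ·Σ·H_iᵀ·(H_i·Σ·H_iᵀ + V_i)⁻¹·H_i·Σ·Φᵀ for symmetric positive semidefinite Σ. Let π_i ≥ 0 with ∑_i π_i = 1, and let Σ₀ be symmetric positive semidefinite. For a word ω = (ω₀,…,ω_{k−1}) of length k over the index set, define Σ_ω by Σ_ε := Σ₀ (empty word) and Σ_{ω·i} := R_i(Σ_ω), and define the deterministic recursion Δ₀ := Σ₀, Δ_{k+1} := ∑_i π_i·R_i(Δ_k). Then each Σ_ω is positive semidefinite,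 and for every k ≥ 0 the matrix Δ_k − ∑_{ω of length k} (∏_{t=0}^{k−1} π_{ω_t})·Σ_ω is positive semidefinite. -/
open Matrix

/-- Covariance after applying the deployment-indexed Riccati maps along a word
`ω = (ω₀, …, ω_{k−1})`: `Σ_ε = Sig0` and `Σ_{ω·i} = R_i (Σ_ω)`. -/
def wordCov {ι M : Type*} (R : ι → M → M) (Sig0 : M) : ∀ k : ℕ, (Fin k → ι) → M
  | 0, _ => Sig0
  | k + 1, ω => R (ω (Fin.last k)) (wordCov R Sig0 k (ω ∘ Fin.castSucc))

/-- The deterministic upper-bound recursion `Δ₀ = Sig0`,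
`Δ_{k+1} = ∑ᵢ πᵢ · R_i(Δ_k)`. -/
noncomputable def deltaRec {ι M : Type*} [Fintype ι] [AddCommMonoid M]
    [Module ℝ M] (p : ι → ℝ) (R : ι → M → M) (Sig0 : M) : ℕ → M
  | 0 => Sig0
  | k + 1 => ∑ i, p i • R i (deltaRec p R Sig0 k)

namespace Matrix

variable {m n : Type*} [Fintype m] [Fintype n]

/-- The covariance update with gain `K`, in Joseph form. -/
def josephUpdate (Φ Q : Matrix n n ℝ) (H : Matrix m n ℝ) (V : Matrix m m ℝ) (K : Matrix n m ℝ)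
    (X : Matrix n n ℝ) : Matrix n n ℝ :=
  (Φ - K * H) * X * (Φ - K * H)ᵀ + K * V * Kᵀ + Q

/-- The discrete-time Riccati operator. -/
noncomputable def riccati [DecidableEq m] (Φ Q : Matrix n n ℝ) (H : Matrix m n ℝ) (V : Matrix m m ℝ)
    (X : Matrix n n ℝ) : Matrix n n ℝ :=
  Φ * X * Φᵀ + Q - Φ * X * Hᵀ * (H * X * Hᵀ + V)⁻¹ * H * X * Φᵀ

/-- The Kalman gain at the covariance `X`. -/
noncomputable def kalmanGain [DecidableEq m] (Φ : Matrix n n ℝ) (H : Matrix m n ℝ)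
    (V : Matrix m m ℝ) (X : Matrix n n ℝ) : Matrix n m ℝ :=
  Φ * X * Hᵀ * (H * X * Hᵀ + V)⁻¹

variable {Φ Q X Y : Matrix n n ℝ} {H : Matrix m n ℝ} {V : Matrix m m ℝ} {K : Matrix n m ℝ}

theorem PosSemidef.mul_mul_transpose_same {k l : Type*} [Fintype k] [Fintype l]
    {A : Matrix k k ℝ} (hA : A.PosSemidef) (B : Matrix l k ℝ) : (B * A * Bᵀ).PosSemidef := by
  simpa only [conjTranspose_eq_transpose_of_trivial] using hA.mul_mul_conjTranspose_same B

theorem posDef_innovation (hV : V.PosDef) (hX : X.PosSemidef) (H : Matrix m n ℝ) :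
    (H * X * Hᵀ + V).PosDef :=
  hV.posSemidef_add (hX.mul_mul_transpose_same H)

theorem josephUpdate_eq_riccati_add [DecidableEq m] (hV : V.PosDef) (hX : X.PosSemidef) :
    josephUpdate Φ Q H V K X = riccati Φ Q H V X +
      (K - kalmanGain Φ H V X) * (H * X * Hᵀ + V) * (K - kalmanGain Φ H V X)ᵀ := by
  have hS := posDef_innovation hV hX H
  have hXt : Xᵀ = X := by simpa using hX.isHermitian.eq
  have hdet : IsUnit (H * X * Hᵀ + V).det := (isUnit_iff_isUnit_det _).mp hS.isUnit
  have hGt : ((H * X * Hᵀ + V)⁻¹)ᵀ = (H * X * Hᵀ + V)⁻¹ := by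
    simpa using hS.inv.isHermitian.eq
  have hKS : kalmanGain Φ H V X * (H * X * Hᵀ + V) = Φ * X * Hᵀ := by
    rw [kalmanGain, Matrix.mul_assoc, nonsing_inv_mul _ hdet, Matrix.mul_one]
  have hSK : (H * X * Hᵀ + V) * (kalmanGain Φ H V X)ᵀ = H * X * Φᵀ := by
    rw [kalmanGain, transpose_mul, hGt, ← Matrix.mul_assoc, mul_nonsing_inv _ hdet, Matrix.one_mul]
    simp only [transpose_mul, transpose_transpose, hXt, Matrix.mul_assoc]
  have hR : riccati Φ Q H V X = Φ * X * Φᵀ + Q - kalmanGain Φ H V X * (H * X * Φᵀ) := by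
    simp only [riccati, kalmanGain, Matrix.mul_assoc]
  have hsq : (K - kalmanGain Φ H V X) * (H * X * Hᵀ + V) * (K - kalmanGain Φ H V X)ᵀ =
      K * (H * X * Hᵀ + V) * Kᵀ - Φ * X * Hᵀ * Kᵀ -
        (K * (H * X * Φᵀ) - kalmanGain Φ H V X * (H * X * Φᵀ)) := by
    rw [transpose_sub, Matrix.mul_sub, Matrix.mul_assoc _ _ (kalmanGain Φ H V X)ᵀ, hSK,
      Matrix.sub_mul _ _ (H * X * Hᵀ + V), hKS, Matrix.sub_mul, Matrix.sub_mul]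
  rw [hR, hsq, josephUpdate]
  simp only [transpose_sub, transpose_mul, Matrix.mul_sub, Matrix.sub_mul, Matrix.mul_add,
    Matrix.add_mul, Matrix.mul_assoc]
  abel

theorem josephUpdate_kalmanGain [DecidableEq m] (hV : V.PosDef) (hX : X.PosSemidef) :
    josephUpdate Φ Q H V (kalmanGain Φ H V X) X = riccati Φ Q H V X := by
  simp [josephUpdate_eq_riccati_add hV hX]

theorem posSemidef_josephUpdate_sub_riccati [DecidableEq m] (hV : V.PosDef) (hX : X.PosSemidef) :
    (josephUpdate Φ Q H V K X - riccati Φ Q H V X).PosSemidef := by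
  rw [josephUpdate_eq_riccati_add hV hX, add_sub_cancel_left]
  exact (posDef_innovation hV hX H).posSemidef.mul_mul_transpose_same _

theorem posSemidef_riccati [DecidableEq m] (hQ : Q.PosSemidef) (hV : V.PosDef) (hX : X.PosSemidef) :
    (riccati Φ Q H V X).PosSemidef := by
  rw [← josephUpdate_kalmanGain hV hX]
  exact ((hX.mul_mul_transpose_same _).add (hV.posSemidef.mul_mul_transpose_same _)).add hQ

theorem josephUpdate_sub :
    josephUpdate Φ Q H V K Y - josephUpdate Φ Q H V K X =
      (Φ - K * H) * (Y - X) * (Φ - K * H)ᵀ := by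
  simp only [josephUpdate, Matrix.mul_sub, Matrix.sub_mul _ _ (Φ - K * H)ᵀ]
  abel

theorem josephUpdate_sum {α : Type*} [Fintype α] {w : α → ℝ} (hw : ∑ a, w a = 1)
    (Y : α → Matrix n n ℝ) :
    josephUpdate Φ Q H V K (∑ a, w a • Y a) = ∑ a, w a • josephUpdate Φ Q H V K (Y a) := by
  simp only [josephUpdate, smul_add, Finset.sum_add_distrib, ← Finset.sum_smul, hw, one_smul,
    Matrix.mul_sum, Matrix.sum_mul, Matrix.mul_smul, Matrix.smul_mul]

/-- Jensen's inequality for the Riccati operator, combined with its monotonicity. -/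
theorem posSemidef_riccati_sub_sum [DecidableEq m] {α : Type*} [Fintype α] {w : α → ℝ} (hw₀ : ∀ a, 0 ≤ w a)
    (hw : ∑ a, w a = 1) {Y : α → Matrix n n ℝ} (hV : V.PosDef) (hX : X.PosSemidef)
    (hY : ∀ a, (Y a).PosSemidef) (hXY : (X - ∑ a, w a • Y a).PosSemidef) :
    (riccati Φ Q H V X - ∑ a, w a • riccati Φ Q H V (Y a)).PosSemidef := by
  have hmono := hXY.mul_mul_transpose_same (Φ - kalmanGain Φ H V X * H)
  rw [← josephUpdate_sub (Q := Q) (V := V), josephUpdate_kalmanGain hV hX,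
    josephUpdate_sum hw] at hmono
  have hgap := posSemidef_sum Finset.univ fun a _ =>
    (posSemidef_josephUpdate_sub_riccati (Φ := Φ) (Q := Q) (H := H)
      (K := kalmanGain Φ H V X) hV (hY a)).smul (hw₀ a)
  simp only [smul_sub, Finset.sum_sub_distrib] at hgap
  simpa using hmono.add hgap

end Matrix

section Words

variable {ι M : Type*} [Fintype ι]

theorem sum_prod_word {p : ι → ℝ} (hp : ∑ i, p i = 1) (k : ℕ) :
    ∑ ω : Fin k → ι, ∏ t, p (ω t) = 1 := by
  classical
  rw [← Fintype.prod_sum fun (_ : Fin k) i => p i]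
  simp [hp]

theorem sum_wordCov_succ [AddCommMonoid M] [Module ℝ M] (p : ι → ℝ) (R : ι → M → M) (x : M)
    (k : ℕ) :
    ∑ ω : Fin (k + 1) → ι, (∏ t, p (ω t)) • wordCov R x (k + 1) ω =
      ∑ i, p i • ∑ ω : Fin k → ι, (∏ t, p (ω t)) • R i (wordCov R x k ω) := by
  rw [← (Fin.snocEquiv fun _ => ι).sum_comp, Fintype.sum_prod_type]
  refine Finset.sum_congr rfl fun i _ => ?_
  rw [Finset.smul_sum]
  refine Finset.sum_congr rfl fun ω _ => ?_
  have hω : (Fin.snocEquiv fun _ => ι) (i, ω) ∘ Fin.castSucc = ω := by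
    ext t
    simp
  simp [wordCov, Fin.prod_univ_castSucc, hω, smul_smul, mul_comm]

end Words

/-- Discrete-time upper bound of Gupta et al.: with sensor deployment `i`
chosen independently with probability `πᵢ` at each step, every realized
Kalman prediction covariance `Σ_ω` is positive semidefinite, and the expected
covariance `∑_{|ω|=k} (∏ₜ π_{ωₜ}) Σ_ω` is dominated in the Loewner order by
the deterministic recursion `Δ_k`. -/
theorem gupta_discrete_upper_bound {n : ℕ}
    (Φ Qd : Matrix (Fin n) (Fin n) ℝ) (hQd : Qd.PosSemidef)
    {ι : Type*} [Fintype ι] (m : ι → ℕ)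
    (H : ∀ i : ι, Matrix (Fin (m i)) (Fin n) ℝ)
    (V : ∀ i : ι, Matrix (Fin (m i)) (Fin (m i)) ℝ) (hV : ∀ i, (V i).PosDef)
    (p : ι → ℝ) (hp : ∀ i, 0 ≤ p i) (hp1 : ∑ i, p i = 1)
    (Sig0 : Matrix (Fin n) (Fin n) ℝ) (hSig0 : Sig0.PosSemidef)
    (R : ι → Matrix (Fin n) (Fin n) ℝ → Matrix (Fin n) (Fin n) ℝ)
    (hR : ∀ i X, R i X
      = Φ * X * Φᵀ + Qd
        - Φ * X * (H i)ᵀ * (H i * X * (H i)ᵀ + V i)⁻¹ * H i * X * Φᵀ) :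
    (∀ (k : ℕ) (ω : Fin k → ι), (wordCov R Sig0 k ω).PosSemidef) ∧
    (∀ k : ℕ,
      (deltaRec p R Sig0 k
        - ∑ ω : Fin k → ι, (∏ t, p (ω t)) • wordCov R Sig0 k ω).PosSemidef) := by
  have hRic : ∀ i X, R i X = riccati Φ Qd (H i) (V i) X := hR
  have hpos : ∀ i X, X.PosSemidef → (R i X).PosSemidef := fun i X hX => by
    rw [hRic]
    exact posSemidef_riccati hQd (hV i) hX
  have hword : ∀ (k : ℕ) (ω : Fin k → ι), (wordCov R Sig0 k ω).PosSemidef := by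
    intro k
    induction k with
    | zero => exact fun _ => hSig0
    | succ k ih => exact fun ω => hpos _ _ (ih _)
  have hdelta : ∀ k, (deltaRec p R Sig0 k).PosSemidef := by
    intro k
    induction k with
    | zero => exact hSig0
    | succ k ih => exact posSemidef_sum _ fun i _ => (hpos i _ ih).smul (hp i)
  refine ⟨hword, fun k => ?_⟩
  induction k with
  | zero => simpa [deltaRec, wordCov] using PosSemidef.zero
  | succ k ih =>
    rw [sum_wordCov_succ, deltaRec, ← Finset.sum_sub_distrib]
    refine posSemidef_sum _ fun i _ => ?_
    rw [← smul_sub]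
    refine PosSemidef.smul ?_ (hp i)
    simp only [hRic i]
    exact posSemidef_riccati_sub_sum (fun ω => Finset.prod_nonneg fun t _ => hp (ω t))
      (sum_prod_word hp1 k) (hV i) (hdelta k) (hword k) ih
end

section
/- Let Φ be a real n×n matrix, Q_d a symmetric positive semidefinite n×n matrix, H a real m×n matrix, and V a symmetric positive definite m×m matrix, and define the discrete-time Riccati operator R(Σ) := Φ·Σ·Φᵀ + Q_d − Φ·Σ·Hᵀ·(H·Σ·Hᵀ + V)⁻¹·H·Σ·Φᵀ. Then R is concave on positive semidefinite matrices with respect to the Loewner order: for all symmetric positive semidefinite n×n matrices Σ₁, Σ₂ and all β ∈ [0,1], the matrix R(βΣ₁ + (1−β)Σ₂) − (β·R(Σ₁) + (1−β)·R(Σ₂)) is positive semidefinite. -/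
open Matrix

/-- The innovation covariance `H X Hᵀ + V` is positive definite. -/
theorem posDef_innovation {n m : Type*} [Fintype n] [Fintype m]
    (H : Matrix m n ℝ) {V : Matrix m m ℝ} (hV : V.PosDef)
    {X : Matrix n n ℝ} (hX : X.PosSemidef) : (H * X * Hᵀ + V).PosDef := by
  have h := hX.mul_mul_conjTranspose_same H
  rw [conjTranspose_eq_transpose_of_trivial] at h
  exact hV.posSemidef_add h

/-- Completing the square: the Riccati operator plus the quadratic penalty for using the gain `K`
instead of the optimal gain is affine in `X`. -/
theorem riccati_add_gain_penalty {n m : Type*} [Fintype n] [Fintype m] [DecidableEq m]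
    (Φ Q : Matrix n n ℝ) (H : Matrix m n ℝ) {V : Matrix m m ℝ} (hV : V.PosDef)
    {X : Matrix n n ℝ} (hX : X.PosSemidef) (K : Matrix n m ℝ) :
    Φ * X * Φᵀ + Q - Φ * X * Hᵀ * (H * X * Hᵀ + V)⁻¹ * H * X * Φᵀ
      + (K - Φ * X * Hᵀ * (H * X * Hᵀ + V)⁻¹) * (H * X * Hᵀ + V)
        * (K - Φ * X * Hᵀ * (H * X * Hᵀ + V)⁻¹)ᵀ
      = Φ * X * Φᵀ + Q - K * H * X * Φᵀ - Φ * X * Hᵀ * Kᵀ + K * (H * X * Hᵀ + V) * Kᵀ := by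
  have hS := posDef_innovation H hV hX
  have hXt : Xᵀ = X := by simpa using hX.isHermitian.eq
  have hSt : ((H * X * Hᵀ + V)⁻¹)ᵀ = (H * X * Hᵀ + V)⁻¹ := by
    simpa using hS.inv.isHermitian.eq
  generalize H * X * Hᵀ + V = S at hS hSt ⊢
  have hdet : IsUnit S.det := (isUnit_iff_isUnit_det S).mp hS.isUnit
  have hSS : ∀ A : Matrix m n ℝ, S * (S⁻¹ * A) = A := fun A => mul_nonsing_inv_cancel_left S A hdet
  have hSS' : ∀ A : Matrix m n ℝ, S⁻¹ * (S * A) = A := fun A => nonsing_inv_mul_cancel_left S A hdet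
  simp only [transpose_sub, transpose_mul, transpose_transpose, hXt, hSt, Matrix.mul_sub,
    Matrix.sub_mul, Matrix.mul_assoc, hSS, hSS']
  abel

/-- Concavity of the discrete-time Kalman Riccati operator
`R(Σ) = ΦΣΦᵀ + Q_d − ΦΣHᵀ(HΣHᵀ + V)⁻¹HΣΦᵀ` on positive semidefinite
matrices with respect to the Loewner order. -/
theorem discrete_riccati_concave {n m : ℕ}
    (Φ Qd : Matrix (Fin n) (Fin n) ℝ) (hQd : Qd.PosSemidef)
    (H : Matrix (Fin m) (Fin n) ℝ) (V : Matrix (Fin m) (Fin m) ℝ)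
    (hV : V.PosDef)
    (R : Matrix (Fin n) (Fin n) ℝ → Matrix (Fin n) (Fin n) ℝ)
    (hR : ∀ X, R X
      = Φ * X * Φᵀ + Qd - Φ * X * Hᵀ * (H * X * Hᵀ + V)⁻¹ * H * X * Φᵀ)
    (X₁ X₂ : Matrix (Fin n) (Fin n) ℝ)
    (h1 : X₁.PosSemidef) (h2 : X₂.PosSemidef)
    (β : ℝ) (hβ : β ∈ Set.Icc (0 : ℝ) 1) :
    (R (β • X₁ + (1 - β) • X₂)
      - (β • R X₁ + (1 - β) • R X₂)).PosSemidef := by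
  obtain ⟨hβ0, hβ1⟩ := hβ
  have hβ1' : 0 ≤ 1 - β := sub_nonneg.mpr hβ1
  have hX : (β • X₁ + (1 - β) • X₂).PosSemidef := (h1.smul hβ0).add (h2.smul hβ1')
  obtain ⟨K, hK⟩ : ∃ K, K = Φ * (β • X₁ + (1 - β) • X₂) * Hᵀ
      * (H * (β • X₁ + (1 - β) • X₂) * Hᵀ + V)⁻¹ := ⟨_, rfl⟩
  have e := riccati_add_gain_penalty Φ Qd H hV hX K
  have e1 := riccati_add_gain_penalty Φ Qd H hV h1 K
  have e2 := riccati_add_gain_penalty Φ Qd H hV h2 K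
  rw [← hR] at e e1 e2
  rw [← hK, sub_self, Matrix.zero_mul, Matrix.zero_mul, add_zero] at e
  have p1 := ((posDef_innovation H hV h1).posSemidef.mul_mul_conjTranspose_same
    (K - Φ * X₁ * Hᵀ * (H * X₁ * Hᵀ + V)⁻¹)).smul hβ0
  have p2 := ((posDef_innovation H hV h2).posSemidef.mul_mul_conjTranspose_same
    (K - Φ * X₂ * Hᵀ * (H * X₂ * Hᵀ + V)⁻¹)).smul hβ1'
  rw [conjTranspose_eq_transpose_of_trivial] at p1 p2
  convert p1.add p2 using 1
  rw [eq_sub_of_add_eq' e1, eq_sub_of_add_eq' e2, e]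
  simp only [Matrix.mul_add, Matrix.add_mul, Matrix.mul_smul, Matrix.smul_mul]
  module
end
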